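/- For integers k, n with 3 ≤ k, 3 ≤ n, k ≢ 2 (mod 4), n ≢ 2 (mod 4), and k ∉ {3, 4}: ℚ(ζₖ + ζₖ⁻¹) ⊆ ℚ(ζₙ + ζₙ⁻¹) if and only if ℚ(ζₖ) ⊆ ℚ(ζₙ). -/

import Mathlib

open Complex IntermediateField

section RootsOfUnity

variable {K : Type*} [Field K]

/-- Rational polynomial relations of a root of unity are preserved by Galois conjugation. -/
lemma IsPrimitiveRoot.aeval_pow_eq_zero [CharZero K] {η : K} {N a : ℕ}
    (hη : IsPrimitiveRoot η N) (hN : 0 < N) (ha : a.Coprime N) {q : Polynomial ℚ} (hq : Polynomial.aeval η q = 0) :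
    Polynomial.aeval (η ^ a) q = 0 := by
  have hmin : minpoly ℚ η = minpoly ℚ (η ^ a) := by
    rw [← Polynomial.cyclotomic_eq_minpoly_rat hη hN,
      ← Polynomial.cyclotomic_eq_minpoly_rat (hη.pow_of_coprime a ha) hN]
  exact (minpoly.dvd_iff).1 (hmin ▸ minpoly.dvd ℚ η hq)

/-- If `η ^ u + η ^ (-u)` lies in `ℚ(η ^ v)`, then it is fixed by every `η ↦ η ^ a`
fixing `η ^ v`. -/
lemma IsPrimitiveRoot.pow_add_inv_eq_of_mem_adjoin [CharZero K] {η : K} {N a u v : ℕ}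
    (hη : IsPrimitiveRoot η N) (hN : 0 < N) (ha : a.Coprime N)
    (hv : (η ^ v) ^ a = η ^ v) (h : η ^ u + (η ^ u)⁻¹ ∈ ℚ⟮η ^ v⟯) :
    (η ^ u) ^ a + ((η ^ u) ^ a)⁻¹ = η ^ u + (η ^ u)⁻¹ := by
  have h0 : η ≠ 0 := hη.ne_zero hN.ne'
  have halg : IsAlgebraic ℚ (η ^ v) := ((hη.isIntegral hN).tower_top.pow v).isAlgebraic
  rw [← IntermediateField.mem_toSubalgebra, adjoin_simple_toSubalgebra_of_isAlgebraic halg,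
    Algebra.adjoin_singleton_eq_range_aeval] at h
  obtain ⟨p, hp⟩ := h
  replace hp : Polynomial.aeval (η ^ v) p = η ^ u + (η ^ u)⁻¹ := hp
  have hq := hη.aeval_pow_eq_zero hN ha
    (q := p.comp (Polynomial.X ^ v) * Polynomial.X ^ u - (Polynomial.X ^ (2 * u) + 1)) (by
      simp only [map_sub, map_mul, map_add, map_pow, map_one, Polynomial.aeval_comp,
        Polynomial.aeval_X, hp]
      field_simp
      ring)
  simp only [map_sub, map_mul, map_add, map_pow, map_one, Polynomial.aeval_comp,
    Polynomial.aeval_X, pow_right_comm η a v, hv, hp, pow_right_comm η a u,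
    pow_mul' (η ^ a) 2 u] at hq
  have hua : (η ^ u) ^ a ≠ 0 := pow_ne_zero _ (pow_ne_zero _ h0)
  apply mul_right_cancel₀ hua
  rw [add_mul, inv_mul_cancel₀ hua]
  linear_combination -hq

lemma IsPrimitiveRoot.pow_eq_self_iff_modEq {ζ : K} {k a : ℕ} (hζ : IsPrimitiveRoot ζ k)
    (hk : 0 < k) : ζ ^ a = ζ ↔ a ≡ 1 [MOD k] := by
  have h := (hζ.isOfFinOrder hk.ne').pow_eq_pow_iff_modEq (n := a) (m := 1)
  rwa [pow_one, ← hζ.eq_orderOf] at h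

lemma IsPrimitiveRoot.modEq_one_or_dvd_add_one {ζ : K} {k a : ℕ} (hζ : IsPrimitiveRoot ζ k)
    (hk : 0 < k) (h : ζ ^ a + (ζ ^ a)⁻¹ = ζ + ζ⁻¹) : a ≡ 1 [MOD k] ∨ k ∣ a + 1 := by
  have h0 : ζ ≠ 0 := hζ.ne_zero hk.ne'
  have hfac : (ζ ^ a - ζ) * (ζ ^ (a + 1) - 1) = 0 := by
    have : ζ ^ a ≠ 0 := pow_ne_zero _ h0
    field_simp at h
    linear_combination h
  rcases mul_eq_zero.1 hfac with h | h
  · exact Or.inl ((hζ.pow_eq_self_iff_modEq hk).1 (sub_eq_zero.1 h))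
  · exact Or.inr ((hζ.pow_eq_one_iff_dvd _).1 (sub_eq_zero.1 h))

lemma pow_add_inv_pow_mem {F : Type*} [Field F] [Algebra F K] (S : IntermediateField F K) {x : K}
    (hx : x ≠ 0) (h : x + x⁻¹ ∈ S) (j : ℕ) : x ^ j + (x ^ j)⁻¹ ∈ S := by
  induction j using Nat.twoStepInduction with
  | zero => simpa using add_mem S.one_mem S.one_mem
  | one => simpa using h
  | more j h₁ h₂ =>
    have : x ^ (j + 2) + (x ^ (j + 2))⁻¹ =
        (x ^ (j + 1) + (x ^ (j + 1))⁻¹) * (x + x⁻¹) - (x ^ j + (x ^ j)⁻¹) := by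
      field_simp
      ring
    rw [this]
    exact sub_mem (mul_mem h₂ h) h₁

end RootsOfUnity

lemma exists_coprime_not_modEq_one_not_dvd_add_one {k : ℕ} (hk : 5 ≤ k) (hk4 : k % 4 ≠ 2) :
    ∃ b : ℕ, b.Coprime k ∧ ¬ b ≡ 1 [MOD k] ∧ ¬ k ∣ b + 1 := by
  rcases Nat.even_or_odd k with he | ho
  · obtain ⟨m, rfl⟩ : 4 ∣ k := by grind
    refine ⟨2 * m + 1, ?_, ?_, ?_⟩
    · have h2 : (2 * m + 1).Coprime 2 := by simp
      have hm : (2 * m + 1).Coprime m := by simp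
      exact (h2.mul_right h2).mul_right hm
    · rw [Nat.ModEq, Nat.mod_eq_of_lt (by omega), Nat.mod_eq_of_lt (by omega)]
      omega
    · exact Nat.not_dvd_of_pos_of_lt (by omega) (by omega)
  · refine ⟨2, (Nat.coprime_two_left).2 ho, ?_, ?_⟩
    · rw [Nat.ModEq, Nat.mod_eq_of_lt (by omega), Nat.mod_eq_of_lt (by omega)]
      omega
    · exact Nat.not_dvd_of_pos_of_lt (by omega) (by omega)

/-- If every unit modulo `k` that is `1` modulo `d ∣ k` is trivial, then `φ(d) = φ(k)`. -/
lemma totient_eq_of_forall_modEq_one {d k : ℕ} (hk : 0 < k) (hd : d ∣ k)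
    (h : ∀ b : ℕ, b.Coprime k → b ≡ 1 [MOD d] → b ≡ 1 [MOD k]) : d.totient = k.totient := by
  have : NeZero k := ⟨hk.ne'⟩
  have : NeZero d := ⟨(Nat.pos_of_dvd_of_pos hd hk).ne'⟩
  rw [← ZMod.card_units_eq_totient, ← ZMod.card_units_eq_totient]
  refine (Fintype.card_of_bijective (f := ZMod.unitsMap hd)
    ⟨(injective_iff_map_eq_one _).2 fun x hx ↦ ?_, ZMod.unitsMap_surjective hd⟩).symm
  have hx' := congrArg Units.val hx
  rw [ZMod.unitsMap_val, Units.val_one, ← ZMod.natCast_val, ← Nat.cast_one,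
    ZMod.natCast_eq_natCast_iff] at hx'
  have := h _ (ZMod.val_coe_unit_coprime x) hx'
  rw [← ZMod.natCast_eq_natCast_iff, ZMod.natCast_zmod_val, Nat.cast_one] at this
  exact Units.ext this

lemma dvd_of_forall_modEq_one {k n : ℕ} (hk : 5 ≤ k) (hk4 : k % 4 ≠ 2)
    (h : ∀ a : ℕ, a.Coprime (k.lcm n) → a ≡ 1 [MOD n] → a ≡ 1 [MOD k] ∨ k ∣ a + 1) :
    k ∣ n := by
  have hd : k.gcd n ∣ k := Nat.gcd_dvd_left k n
  have hlift : ∀ b : ℕ, b.Coprime k → b ≡ 1 [MOD k.gcd n] → b ≡ 1 [MOD k] ∨ k ∣ b + 1 := by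
    intro b hb hb1
    obtain ⟨a, hak, han⟩ := Nat.chineseRemainder' hb1
    have hck : a.Coprime k := by rw [Nat.Coprime, hak.gcd_eq]; exact hb
    have hcn : a.Coprime n := by rw [Nat.Coprime, han.gcd_eq]; simp
    rcases h a (Nat.Coprime.coprime_dvd_right (Nat.lcm_dvd_mul k n) (hck.mul_right hcn)) han
      with h | h
    · exact Or.inl (hak.symm.trans h)
    · exact Or.inr (((hak.add_right 1).dvd_iff dvd_rfl).1 h)
  by_cases h2 : k.gcd n ∣ 2
  · obtain ⟨b, hb, hb1, hb2⟩ := exists_coprime_not_modEq_one_not_dvd_add_one hk hk4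
    refine ((hlift b hb ?_).elim hb1 hb2).elim
    have hbd := hb.coprime_dvd_right hd
    rcases (Nat.dvd_prime Nat.prime_two).1 h2 with h | h
    · rw [h]; exact Nat.modEq_one
    · rw [h] at hbd ⊢
      exact Nat.odd_iff.1 (Nat.coprime_two_right.1 hbd)
  · have htot := totient_eq_of_forall_modEq_one (by omega) hd fun b hb hb1 ↦
      (hlift b hb hb1).resolve_right fun hdvd ↦
        h2 (((hb1.add_right 1).dvd_iff dvd_rfl).1 (hd.trans hdvd))
    rcases Nat.eq_or_eq_of_totient_eq_totient hd htot with h | h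
    · exact Nat.gcd_eq_left_iff_dvd.1 h
    · rcases Nat.even_or_odd (k.gcd n) with he | ho
      · exact Nat.gcd_eq_left_iff_dvd.1 (he.eq_of_totient_eq_totient hd htot)
      · obtain ⟨m, hm⟩ := ho
        omega

lemma dvd_of_add_inv_mem_adjoin {k n : ℕ} (hk : 5 ≤ k) (hn : 0 < n) (hk4 : k % 4 ≠ 2)
    (h : exp (2 * Real.pi * I / k) + (exp (2 * Real.pi * I / k))⁻¹ ∈
      ℚ⟮exp (2 * Real.pi * I / n)⟯) : k ∣ n := by
  have hk0 : 0 < k := by omega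
  have hL : 0 < k.lcm n := Nat.lcm_pos hk0 hn
  have hη := isPrimitiveRoot_exp (k.lcm n) hL.ne'
  have hζ := isPrimitiveRoot_exp k hk0.ne'
  have hpow : ∀ m u : ℕ, 0 < m → k.lcm n = m * u →
      exp (2 * Real.pi * I / m) = exp (2 * Real.pi * I / (k.lcm n : ℕ)) ^ u := by
    intro m u hm hu
    rw [← exp_nat_mul, hu]
    have hu0 : (u : ℂ) ≠ 0 := by
      rw [Nat.cast_ne_zero]; rintro rfl; omega
    have hm0 : (m : ℂ) ≠ 0 := by exact_mod_cast hm.ne'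
    congr 1
    push_cast
    field_simp
  obtain ⟨u, hu⟩ := Nat.dvd_lcm_left k n
  obtain ⟨v, hv⟩ := Nat.dvd_lcm_right k n
  refine dvd_of_forall_modEq_one hk hk4 fun a ha han ↦ ?_
  have hfix : exp (2 * Real.pi * I / n) ^ a = exp (2 * Real.pi * I / n) :=
    ((isPrimitiveRoot_exp n hn.ne').pow_eq_self_iff_modEq hn).2 han
  refine hζ.modEq_one_or_dvd_add_one hk0 ?_
  rw [hpow n v hn hv] at hfix
  rw [hpow n v hn hv, hpow k u hk0 hu] at h
  rw [hpow k u hk0 hu]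
  exact hη.pow_add_inv_eq_of_mem_adjoin hL ha hfix h



/-- For `k, n ≥ 3` with `k, n ≢ 2 (mod 4)` and `k ∉ {3, 4}`:
`ℚ(ζₖ + ζₖ⁻¹) ⊆ ℚ(ζₙ + ζₙ⁻¹)` iff `ℚ(ζₖ) ⊆ ℚ(ζₙ)`. -/
theorem stmt_19 (k n : ℕ) (hk : 3 ≤ k) (hn : 3 ≤ n)
    (hk4 : k % 4 ≠ 2) (hn4 : n % 4 ≠ 2) (hk3 : k ≠ 3) (hk4' : k ≠ 4) :
    let ζk : ℂ := Complex.exp (2 * Real.pi * Complex.I / k)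
    let ζn : ℂ := Complex.exp (2 * Real.pi * Complex.I / n)
    ((ℚ⟮ζk + ζk⁻¹⟯ : IntermediateField ℚ ℂ) ≤ ℚ⟮ζn + ζn⁻¹⟯) ↔
      ((ℚ⟮ζk⟯ : IntermediateField ℚ ℂ) ≤ ℚ⟮ζn⟯) := by
  intro ζk ζn
  have hle : ∀ {x : ℂ} {S : IntermediateField ℚ ℂ}, x ∈ S → (ℚ⟮x⟯ : IntermediateField ℚ ℂ) ≤ S :=
    fun hx ↦ adjoin_simple_le_iff.2 hx
  have hadd : ∀ {x : ℂ} {S : IntermediateField ℚ ℂ}, x ∈ S → x + x⁻¹ ∈ S :=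
    fun hx ↦ add_mem hx (inv_mem hx)
  have hk5 : 5 ≤ k := by omega
  have hζn : IsPrimitiveRoot ζn n := isPrimitiveRoot_exp n (by omega)
  have hζk : IsPrimitiveRoot ζk k := isPrimitiveRoot_exp k (by omega)
  have : NeZero n := ⟨by omega⟩
  have hpow : k ∣ n → ∃ j : ℕ, ζn ^ j = ζk := fun hdvd ↦ by
    obtain ⟨j, -, hj⟩ := hζn.eq_pow_of_pow_eq_one ((hζk.pow_eq_one_iff_dvd n).2 hdvd)
    exact ⟨j, hj⟩
  constructor <;> intro h
  · obtain ⟨j, hj⟩ := hpow (dvd_of_add_inv_mem_adjoin hk5 (by omega) hk4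
      (hle (hadd (mem_adjoin_simple_self ℚ ζn)) (h (mem_adjoin_simple_self ℚ _))))
    exact hle (hj ▸ pow_mem (mem_adjoin_simple_self ℚ ζn) j)
  · obtain ⟨j, hj⟩ := hpow (dvd_of_add_inv_mem_adjoin hk5 (by omega) hk4
      (hadd (h (mem_adjoin_simple_self ℚ _))))
    exact hle (hj ▸ pow_add_inv_pow_mem _ (hζn.ne_zero (by omega)) (mem_adjoin_simple_self ℚ _) j)
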